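/- arXiv:2406.12748 — 2 statements merged into one kernel-verified Lean document; each statement's English description precedes it below -/
import Mathlib

section
/- Let A be a complex unital Banach algebra and let H, D ∈ A and δ > 0 satisfy: (i) ‖exp(u•H)‖ ≤ 1, ‖exp(u•D)‖ ≤ 1 and ‖exp(u•(H + D))‖ ≤ 1 for every u ∈ [0, δ], and (ii) (‖H‖/2 + ‖D‖)·δ ≤ 1. Then ‖exp(δ•(H + D)) − exp((δ/2)•H) * exp(δ•D) * exp((δ/2)•H)‖ ≤ (‖H*D − D*H‖/3)·(‖H‖/2 + ‖D‖)·δ³. -/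
open NormedSpace

section

variable {A : Type*} [NormedRing A]

lemma norm_mul_le_of_right_contraction {a b : A} {c : ℝ} (ha : ‖a‖ ≤ c) (hb : ‖b‖ ≤ 1) :
    ‖a * b‖ ≤ c :=
  (norm_mul_le a b).trans ((mul_le_of_le_one_right (norm_nonneg a) hb).trans ha)

lemma norm_mul_le_of_left_contraction {a b : A} {c : ℝ} (ha : ‖a‖ ≤ 1) (hb : ‖b‖ ≤ c) :
    ‖a * b‖ ≤ c :=
  (norm_mul_le a b).trans ((mul_le_of_le_one_left (norm_nonneg b) ha).trans hb)

lemma norm_commutator_le (X Y : A) : ‖X * Y - Y * X‖ ≤ 2 * ‖X‖ * ‖Y‖ := by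
  linarith [norm_sub_le (X * Y) (Y * X), norm_mul_le X Y, norm_mul_le Y X]

variable [NormedAlgebra ℝ A]

lemma commute_exp_smul (X : A) (s : ℝ) : exp (s • X) * X = X * exp (s • X) :=
  ((Commute.refl X).smul_left s).exp_left.eq

/-- A function whose derivative has norm at most `B'` moves by at most the increment of `B`. -/
lemma norm_sub_le_of_norm_deriv_le {f f' : ℝ → A} {B B' : ℝ → ℝ} {t : ℝ} (ht : 0 ≤ t)
    (hf : ∀ s, HasDerivAt f (f' s) s) (hB : ∀ s, HasDerivAt B (B' s) s) (hB0 : B 0 = 0)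
    (h : ∀ s, 0 ≤ s → s ≤ t → ‖f' s‖ ≤ B' s) : ‖f t - f 0‖ ≤ B t :=
  image_norm_le_of_norm_deriv_right_le_deriv_boundary (f := fun s => f s - f 0) (a := 0) (b := t)
    (fun s _ => ((hf s).sub_const _).continuousAt.continuousWithinAt)
    (fun s _ => ((hf s).sub_const _).hasDerivWithinAt) (by simp [hB0]) hB
    (fun s hs => h s hs.1 hs.2.le) ⟨ht, le_rfl⟩

variable [CompleteSpace A]

lemma exp_smul_mul_exp_sub_smul (X : A) (s t : ℝ) :
    exp (s • X) * exp ((t - s) • X) = exp (t • X) := by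
  let _ : NormedAlgebra ℚ A := NormedAlgebra.restrictScalars ℚ ℝ A
  rw [← exp_add_of_commute (((Commute.refl X).smul_left s).smul_right (t - s)), ← add_smul,
    add_sub_cancel]

lemma hasDerivAt_exp_sub_smul (X : A) (s t : ℝ) :
    HasDerivAt (fun s : ℝ => exp ((t - s) • X)) (-(X * exp ((t - s) • X))) s :=
  ((hasDerivAt_exp_smul_const' X (t - s)).scomp s ((hasDerivAt_id s).const_sub t)).congr_deriv
    (by simp)

lemma hasDerivAt_exp_smul_mul_mul_exp_sub_smul (X Y : A) (s t : ℝ) :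
    HasDerivAt (fun s : ℝ => exp (s • X) * Y * exp ((t - s) • X))
      (exp (s • X) * (X * Y - Y * X) * exp ((t - s) • X)) s := by
  refine (((hasDerivAt_exp_smul_const X s).mul_const Y).mul
    (hasDerivAt_exp_sub_smul X s t)).congr_deriv ?_
  simp only [mul_sub, sub_mul, mul_neg, mul_assoc]
  abel

lemma norm_commutator_exp_le {X : A} {t : ℝ} (ht : 0 ≤ t)
    (hX : ∀ u, 0 ≤ u → u ≤ t → ‖exp (u • X)‖ ≤ 1) (Y : A) :
    ‖exp (t • X) * Y - Y * exp (t • X)‖ ≤ t * ‖X * Y - Y * X‖ := by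
  have := norm_sub_le_of_norm_deriv_le (B := fun s => s * ‖X * Y - Y * X‖)
    (B' := fun _ => ‖X * Y - Y * X‖) ht
    (fun s => hasDerivAt_exp_smul_mul_mul_exp_sub_smul X Y s t)
    (fun s => by simpa using (hasDerivAt_id s).mul_const ‖X * Y - Y * X‖) (by simp)
    (fun s h0 hs => norm_mul_le_of_right_contraction
      (norm_mul_le_of_left_contraction (hX s h0 hs) le_rfl)
      (hX _ (by linarith) (by linarith)))
  simpa using this

lemma norm_commutator_exp_sub_exp_mul_le {X : A} {t : ℝ} (ht : 0 ≤ t)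
    (hX : ∀ u, 0 ≤ u → u ≤ t → ‖exp (u • X)‖ ≤ 1) {Y C : A} (hC : X * Y - Y * X = C) :
    ‖exp (t • X) * Y - Y * exp (t • X) - t • (exp (t • X) * C)‖
      ≤ t ^ 2 / 2 * ‖X * C - C * X‖ := by
  set K := ‖X * C - C * X‖
  have := norm_sub_le_of_norm_deriv_le (B := fun s => (t * s - s ^ 2 / 2) * K)
    (B' := fun s => (t - s) * K) ht
    (fun s => (hasDerivAt_exp_smul_mul_mul_exp_sub_smul X Y s t).sub
      ((hasDerivAt_id s).smul_const (exp (t • X) * C)))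
    (fun s => ((((hasDerivAt_id s).const_mul t).sub
      (((hasDerivAt_id s).pow 2).div_const 2)).mul_const K).congr_deriv (by simp)) (by simp)
    (fun s h0 hs => by
      rw [hC, one_smul, ← exp_smul_mul_exp_sub_smul X s t, mul_assoc, mul_assoc, ← mul_sub]
      refine norm_mul_le_of_left_contraction (hX s h0 hs) ?_
      rw [norm_sub_rev]
      exact norm_commutator_exp_le (sub_nonneg.2 hs) (fun u h0 hu => hX u h0 (by linarith)) C)
  convert this using 1
  · simp; congr 1; abel
  · ring

lemma norm_commutator_exp_sub_mul_exp_le {X : A} {t : ℝ} (ht : 0 ≤ t)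
    (hX : ∀ u, 0 ≤ u → u ≤ t → ‖exp (u • X)‖ ≤ 1) {Y C : A} (hC : X * Y - Y * X = C) :
    ‖exp (t • X) * Y - Y * exp (t • X) - t • (C * exp (t • X))‖
      ≤ t ^ 2 / 2 * ‖X * C - C * X‖ := by
  set K := ‖X * C - C * X‖
  have := norm_sub_le_of_norm_deriv_le (B := fun s => s ^ 2 / 2 * K)
    (B' := fun s => s * K) ht
    (fun s => (hasDerivAt_exp_smul_mul_mul_exp_sub_smul X Y s t).sub
      ((hasDerivAt_id s).smul_const (C * exp (t • X))))
    (fun s => ((((hasDerivAt_id s).pow 2).div_const 2).mul_const K).congr_deriv (by simp)) (by simp)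
    (fun s h0 hs => by
      rw [hC, one_smul, ← exp_smul_mul_exp_sub_smul X s t, ← mul_assoc, ← sub_mul]
      exact norm_mul_le_of_right_contraction
        (norm_commutator_exp_le h0 (fun u h0 hu => hX u h0 (by linarith)) C)
        (hX _ (by linarith) (by linarith)))
  convert this using 1
  simp; congr 1; abel

/-- The defect of the symmetric splitting in the evolution equation generated by `P + D + P`. -/
lemma norm_strang_defect_le {P D : A} {t : ℝ} (ht : 0 ≤ t)
    (hP : ∀ u, 0 ≤ u → u ≤ t → ‖exp (u • P)‖ ≤ 1)
    (hD : ∀ u, 0 ≤ u → u ≤ t → ‖exp (u • D)‖ ≤ 1) :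
    ‖(exp (t • P) * D - D * exp (t • P)) * exp (t • D) * exp (t • P)
        + exp (t • P) * (exp (t • D) * P - P * exp (t • D)) * exp (t • P)‖
      ≤ t ^ 2 * ‖P * D - D * P‖ * (‖P‖ + ‖D‖) := by
  set C := P * D - D * P with hC
  have h1 := norm_commutator_exp_sub_exp_mul_le ht hP hC.symm
  have h2 := norm_commutator_exp_sub_mul_exp_le ht hD (Y := P) (C := -C) (by rw [hC]; abel)
  have hPt := hP t ht le_rfl
  have hsplit : (exp (t • P) * D - D * exp (t • P)) * exp (t • D) * exp (t • P)
        + exp (t • P) * (exp (t • D) * P - P * exp (t • D)) * exp (t • P)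
      = (exp (t • P) * D - D * exp (t • P) - t • (exp (t • P) * C)) * exp (t • D) * exp (t • P)
        + exp (t • P) * (exp (t • D) * P - P * exp (t • D) - t • (-C * exp (t • D)))
          * exp (t • P) := by
    simp only [sub_mul, mul_sub, smul_mul_assoc, mul_smul_comm, neg_mul, mul_neg, smul_neg,
      mul_assoc]
    abel
  rw [hsplit]
  refine (norm_add_le _ _).trans ((add_le_add
    (norm_mul_le_of_right_contraction (norm_mul_le_of_right_contraction h1 (hD t ht le_rfl)) hPt)
    (norm_mul_le_of_right_contraction (norm_mul_le_of_left_contraction hPt h2) hPt)).trans ?_)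
  have k1 := norm_commutator_le P C
  have k2 := norm_commutator_le D (-C)
  rw [norm_neg] at k2
  nlinarith [mul_le_mul_of_nonneg_left k1 (sq_nonneg t),
    mul_le_mul_of_nonneg_left k2 (sq_nonneg t)]

lemma norm_exp_sub_strang_le {P D : A} {t : ℝ} (ht : 0 ≤ t)
    (hP : ∀ u, 0 ≤ u → u ≤ t → ‖exp (u • P)‖ ≤ 1)
    (hD : ∀ u, 0 ≤ u → u ≤ t → ‖exp (u • D)‖ ≤ 1)
    (hPD : ∀ u, 0 ≤ u → u ≤ t → ‖exp (u • (P + P + D))‖ ≤ 1) :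
    ‖exp (t • (P + P + D)) - exp (t • P) * exp (t • D) * exp (t • P)‖
      ≤ t ^ 3 / 3 * (‖P * D - D * P‖ * (‖P‖ + ‖D‖)) := by
  set K := ‖P * D - D * P‖ * (‖P‖ + ‖D‖)
  set L := P + P + D with hL
  have := norm_sub_le_of_norm_deriv_le (B := fun s => s ^ 3 / 3 * K)
    (B' := fun s => s ^ 2 * K)
    (f := fun s => exp ((t - s) • L) * (exp (s • P) * exp (s • D) * exp (s • P)))
    (f' := fun s => exp ((t - s) • L) *
      ((exp (s • P) * D - D * exp (s • P)) * exp (s • D) * exp (s • P)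
        + exp (s • P) * (exp (s • D) * P - P * exp (s • D)) * exp (s • P))) ht
    (fun s => by
      refine ((hasDerivAt_exp_sub_smul L s t).mul
        (((hasDerivAt_exp_smul_const' P s).mul (hasDerivAt_exp_smul_const' D s)).mul
          (hasDerivAt_exp_smul_const' P s))).congr_deriv ?_
      rw [← commute_exp_smul L]
      have hcomm : exp (s • P) * (P * (exp (s • D) * exp (s • P)))
          = P * (exp (s • P) * (exp (s • D) * exp (s • P))) := by
        rw [← mul_assoc, commute_exp_smul, mul_assoc]
      simp only [Pi.mul_apply, hL, mul_add, add_mul, mul_sub, sub_mul, mul_assoc, hcomm,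
        neg_add_rev, neg_mul]
      abel)
    (fun s => ((((hasDerivAt_id s).pow 3).div_const 3).mul_const K).congr_deriv (by simp)) (by simp)
    (fun s h0 hs => by
      refine norm_mul_le_of_left_contraction (hPD _ (by linarith) (by linarith)) ?_
      refine (norm_strang_defect_le h0 (fun u h0 hu => hP u h0 (hu.trans hs))
        (fun u h0 hu => hD u h0 (hu.trans hs))).trans_eq (mul_assoc _ _ _))
  rw [norm_sub_rev]
  simpa using this

end

theorem strang_product_formula {A : Type*} [NormedRing A] [NormedAlgebra ℂ A]
    [CompleteSpace A] (H D : A) (δ : ℝ) (hδ : 0 < δ)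
    (hH : ∀ u ∈ Set.Icc (0 : ℝ) δ, ‖exp (u • H)‖ ≤ 1)
    (hD : ∀ u ∈ Set.Icc (0 : ℝ) δ, ‖exp (u • D)‖ ≤ 1)
    (hHD : ∀ u ∈ Set.Icc (0 : ℝ) δ, ‖exp (u • (H + D))‖ ≤ 1)
    (hnorm : (‖H‖ / 2 + ‖D‖) * δ ≤ 1) :
    ‖exp (δ • (H + D)) - exp ((δ / 2) • H) * exp (δ • D) * exp ((δ / 2) • H)‖
      ≤ (‖H * D - D * H‖ / 3) * (‖H‖ / 2 + ‖D‖) * δ ^ 3 := by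
  have hhalf (u : ℝ) : u • ((1 / 2 : ℝ) • H) = (u / 2) • H := by
    rw [smul_smul, mul_one_div]
  have hsum : (1 / 2 : ℝ) • H + (1 / 2 : ℝ) • H + D = H + D := by
    rw [← add_smul]; norm_num
  have hcomm : ((1 / 2 : ℝ) • H) * D - D * ((1 / 2 : ℝ) • H) = (1 / 2 : ℝ) • (H * D - D * H) := by
    rw [smul_mul_assoc, mul_smul_comm, smul_sub]
  have key := norm_exp_sub_strang_le (P := (1 / 2 : ℝ) • H) (D := D) hδ.le
    (fun u h0 hu => by rw [hhalf]; exact hH _ ⟨by linarith, by linarith⟩)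
    (fun u h0 hu => hD u ⟨h0, hu⟩)
    (fun u h0 hu => by rw [hsum]; exact hHD u ⟨h0, hu⟩)
  have hn (X : A) : ‖(1 / 2 : ℝ) • X‖ = ‖X‖ / 2 := by
    rw [norm_smul, Real.norm_of_nonneg (by norm_num)]; ring
  rw [hhalf, hsum, hcomm, hn, hn] at key
  have hpos : 0 ≤ δ ^ 3 * (‖H * D - D * H‖ * (‖H‖ / 2 + ‖D‖)) := by positivity
  linarith
end

section
/- Let d and m be positive natural numbers, let α : Fin m → ℂ, and let U : Fin m → Matrix (Fin d) (Fin d) ℂ be such that each U μ is unitary. Let R be the continuous linear endomorphism of Matrix (Fin d) (Fin d) ℂ given by R(ρ) = ∑_{μ} (‖α μ‖²) • ((U μ) * ρ * (U μ)ᴴ), set a = ∑_{μ} ‖α μ‖², and let 𝒟 = R − a • id. Then for every δ ≥ 0 and every ρ : Matrix (Fin d) (Fin d) ℂ: (a) (exp(δ • 𝒟)) ρ = ∑'_{k : ℕ} (e^{−aδ} · δ^k / k!) • (R^k ρ) (a tsum over k), and (b) if ρ is positive semidefinite then (exp(δ • 𝒟)) ρ is positive semidefinite. -/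
open Matrix
open scoped ComplexOrder

attribute [local instance] Matrix.normedAddCommGroup Matrix.normedSpace

theorem isTopologicalRing_clm_aux (E : Type) [NormedAddCommGroup E] [NormedSpace ℂ E] :
    IsTopologicalRing (E →L[ℂ] E) :=
  inferInstance

instance isTopologicalRing_matrix_clm (d : ℕ) :
    IsTopologicalRing (Matrix (Fin d) (Fin d) ℂ →L[ℂ] Matrix (Fin d) (Fin d) ℂ) :=
  isTopologicalRing_clm_aux (Matrix (Fin d) (Fin d) ℂ)

theorem hasSum_exp_smul_sub_smul_id {E : Type*} [NormedAddCommGroup E] [NormedSpace ℂ E]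
    [CompleteSpace E] (R : E →L[ℂ] E) (a δ : ℂ) (x : E) :
    HasSum (fun k : ℕ => (Complex.exp (-(a * δ)) * δ ^ k / (Nat.factorial k : ℂ)) • (R ^ k) x)
      (NormedSpace.exp (δ • (R - a • ContinuousLinearMap.id ℂ E)) x) := by
  let _ : NormedAlgebra ℚ (E →L[ℂ] E) := NormedAlgebra.restrictScalars ℚ ℂ _
  have hsplit : δ • (R - a • ContinuousLinearMap.id ℂ E)
      = algebraMap ℂ (E →L[ℂ] E) (-(a * δ)) + δ • R := by
    ext y
    simp [Algebra.algebraMap_eq_smul_one, smul_sub, smul_smul, mul_comm]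
    abel
  rw [hsplit, NormedSpace.exp_add_of_commute (Algebra.commutes _ _),
    ← NormedSpace.algebraMap_exp_comm, ← Complex.exp_eq_exp_ℂ]
  have h := (NormedSpace.exp_series_hasSum_exp' (𝕂 := ℂ) (δ • R)).mapL
    (ContinuousLinearMap.apply ℂ E x)
  convert h.const_smul (Complex.exp (-(a * δ))) using 1
  · ext k
    simp [smul_pow, smul_smul]
    ring_nf
  · simp [Algebra.algebraMap_eq_smul_one]

theorem isClosed_setOf_posSemidef {n : Type*} [Fintype n] :
    IsClosed {A : Matrix n n ℂ | A.PosSemidef} := by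
  simp only [posSemidef_iff_dotProduct_mulVec, Set.ofPred_and, Set.ofPred_forall]
  refine (isClosed_eq (by fun_prop) continuous_id).inter (isClosed_iInter fun x => ?_)
  exact isClosed_le continuous_const (by fun_prop)

theorem exp_dissipator_unitary_jumps_series_and_posSemidef (d m : ℕ)
    (hd : 0 < d) (hm : 0 < m)
    (α : Fin m → ℂ) (U : Fin m → Matrix (Fin d) (Fin d) ℂ)
    (hU : ∀ μ, (U μ)ᴴ * U μ = 1)
    (R : Matrix (Fin d) (Fin d) ℂ →L[ℂ] Matrix (Fin d) (Fin d) ℂ)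
    (hR : ∀ ρ, R ρ = ∑ μ, (‖α μ‖ ^ 2) • (U μ * ρ * (U μ)ᴴ))
    (a : ℝ) (ha : a = ∑ μ, ‖α μ‖ ^ 2)
    (𝒟 : Matrix (Fin d) (Fin d) ℂ →L[ℂ] Matrix (Fin d) (Fin d) ℂ)
    (h𝒟 : 𝒟 = R - a • ContinuousLinearMap.id ℂ (Matrix (Fin d) (Fin d) ℂ))
    (δ : ℝ) (hδ : 0 ≤ δ) (ρ : Matrix (Fin d) (Fin d) ℂ) :
    (NormedSpace.exp (δ • 𝒟)) ρ
        = ∑' k : ℕ, (Real.exp (-(a * δ)) * δ ^ k / (Nat.factorial k : ℝ)) • ((R ^ k) ρ) ∧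
      (ρ.PosSemidef → ((NormedSpace.exp (δ • 𝒟)) ρ).PosSemidef) := by
  have hsum : HasSum
      (fun k : ℕ => (Real.exp (-(a * δ)) * δ ^ k / (Nat.factorial k : ℝ)) • ((R ^ k) ρ))
      (NormedSpace.exp (δ • 𝒟) ρ) := by
    have h := hasSum_exp_smul_sub_smul_id R (a : ℂ) (δ : ℂ) ρ
    have hgen : (δ : ℂ) • (R - (a : ℂ) • ContinuousLinearMap.id ℂ (Matrix (Fin d) (Fin d) ℂ))
        = δ • 𝒟 := by
      subst h𝒟
      ext A i j
      simp
    have hterm : (fun k : ℕ =>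
          (Real.exp (-(a * δ)) * δ ^ k / (Nat.factorial k : ℝ)) • ((R ^ k) ρ))
        = fun k : ℕ =>
          (Complex.exp (-(a * δ)) * δ ^ k / (Nat.factorial k : ℂ)) • ((R ^ k) ρ) := by
      ext k i j
      simp
    rw [← hgen, hterm]
    exact h
  refine ⟨hsum.tsum_eq.symm, fun hρ => ?_⟩
  have hpow (k : ℕ) : ((R ^ k) ρ).PosSemidef := by
    induction k with
    | zero => simpa using hρ
    | succ k ih =>
      rw [pow_succ', mul_apply_eq_comp, hR]
      exact posSemidef_sum _ fun μ _ => (ih.mul_mul_conjTranspose_same (U μ)).smul (by positivity)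
  refine isClosed_setOf_posSemidef.mem_of_tendsto hsum (.of_forall fun s => ?_)
  exact posSemidef_sum s fun k _ => (hpow k).smul (by positivity)
end
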